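/- Let X be a Polish space and u : C_b(X) → ℝ a coherent monetary utility function with the Fatou property, i.e. u is concave and positively homogeneous, u(f) ≥ 0 for f ≥ 0, u(f + a) = u(f) + a for constants a, and u(f_n) ↓ u(f) whenever f_n ↓ f pointwise with f_n, f ∈ C_b(X). Then there exists a convex set S₀ of Borel probability measures on X, closed in the weak* topology, such that u(f) = inf { ∫ f dμ : μ ∈ S₀ } for all f ∈ C_b(X). -/

import Mathlib

open Set Topology Filter MeasureTheory BoundedContinuousFunction

/-- The restriction to `X` of a continuous function on the Stone-Čech compactification. -/
noncomputable def stoneCechRestrict (X : Type*) [TopologicalSpace X] :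
    C(StoneCech X, ℝ) →ₗ[ℝ] (X →ᵇ ℝ) where
  toFun F := (BoundedContinuousFunction.mkOfCompact F).compContinuous
    ⟨stoneCechUnit, continuous_stoneCechUnit⟩
  map_add' _ _ := rfl
  map_smul' _ _ := rfl

@[simp]
lemma stoneCechRestrict_apply {X : Type*} [TopologicalSpace X] (F : C(StoneCech X, ℝ)) (x : X) :
    stoneCechRestrict X F x = F (stoneCechUnit x) := rfl

/-- Every bounded continuous function extends to the Stone-Čech compactification. -/
lemma stoneCechRestrict_surjective (X : Type*) [TopologicalSpace X] :
    Function.Surjective (stoneCechRestrict X) := by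
  intro f
  have hmem : ∀ x, f x ∈ Icc (-‖f‖) ‖f‖ := fun x => abs_le.mp (f.norm_coe_le_norm x)
  have hg : Continuous (codRestrict f (Icc (-‖f‖) ‖f‖) hmem) := f.continuous.codRestrict hmem
  refine ⟨⟨fun z => (stoneCechExtend hg z : Icc (-‖f‖) ‖f‖),
    continuous_subtype_val.comp (continuous_stoneCechExtend hg)⟩, ?_⟩
  ext x
  simp

lemma stoneCech_nonneg_of_restrict_nonneg {X : Type*} [TopologicalSpace X] {F : C(StoneCech X, ℝ)}
    (h : ∀ x, 0 ≤ stoneCechRestrict X F x) (z : StoneCech X) : 0 ≤ F z :=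
  denseRange_stoneCechUnit.induction_on z (isClosed_le continuous_const F.continuous) h

/-- The distance to the first `n + 1` points of a dense sequence, truncated at `1`. -/
noncomputable def truncDist (X : Type*) [MetricSpace X] [TopologicalSpace.SeparableSpace X] [Nonempty X] (n : ℕ) :
    X →ᵇ ℝ :=
  BoundedContinuousFunction.ofNormedAddCommGroup
    (fun x => min 1 (Metric.infDist x (TopologicalSpace.denseSeq X '' Iic n)))
    (continuous_const.min (Metric.continuous_infDist_pt _)) 1
    (fun x => by
      rw [Real.norm_of_nonneg (le_min zero_le_one Metric.infDist_nonneg)]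
      exact min_le_left _ _)

section TruncDist

variable {X : Type*} [MetricSpace X] [TopologicalSpace.SeparableSpace X] [Nonempty X]

lemma truncDist_apply (n : ℕ) (x : X) :
    truncDist X n x = min 1 (Metric.infDist x (TopologicalSpace.denseSeq X '' Iic n)) := rfl

lemma truncDist_nonneg (n : ℕ) (x : X) : 0 ≤ truncDist X n x :=
  le_min zero_le_one Metric.infDist_nonneg

lemma truncDist_antitone (x : X) : Antitone fun n => truncDist X n x := by
  intro m n hmn
  exact min_le_min_left _ (Metric.infDist_le_infDist_of_subset
    (image_mono (Iic_subset_Iic.mpr hmn)) (nonempty_Iic.image _))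

lemma exists_truncDist_lt (x : X) {ε : ℝ} (hε : 0 < ε) : ∃ n, truncDist X n x < ε := by
  obtain ⟨n, hn⟩ := (TopologicalSpace.denseRange_denseSeq X).exists_dist_lt x hε
  refine ⟨n, (min_le_right _ _).trans_lt ?_⟩
  exact (Metric.infDist_lt_iff (nonempty_Iic.image _)).mpr
    ⟨_, mem_image_of_mem _ (mem_Iic.mpr le_rfl), hn⟩

lemma tendsto_truncDist (x : X) : Tendsto (fun n => truncDist X n x) atTop (𝓝 0) := by
  rw [Metric.tendsto_atTop]
  intro ε hε
  obtain ⟨N, hN⟩ := exists_truncDist_lt x hε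
  refine ⟨N, fun n hn => ?_⟩
  rw [Real.dist_0_eq_abs, abs_of_nonneg (truncDist_nonneg n x)]
  exact (truncDist_antitone x hn).trans_lt hN

/-- A point of the Stone-Čech compactification of a complete separable metric space at which the
extended truncated distances get arbitrarily small comes from the space. -/
lemma mem_range_stoneCechUnit_of_truncDist [CompleteSpace X] {G : ℕ → C(StoneCech X, ℝ)}
    (hG : ∀ n, stoneCechRestrict X (G n) = truncDist X n) {z : StoneCech X}
    (hz : ∀ ε > 0, ∃ n, G n z < ε) : z ∈ range (stoneCechUnit : X → StoneCech X) := by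
  have hne : (comap (stoneCechUnit : X → StoneCech X) (𝓝 z)).NeBot :=
    comap_neBot fun t ht => by
      obtain ⟨_, hxt, x, rfl⟩ := mem_closure_iff_nhds.mp (denseRange_stoneCechUnit z) t ht
      exact ⟨x, hxt⟩
  set U : Ultrafilter X := Ultrafilter.of (comap stoneCechUnit (𝓝 z))
  have hU : (U : Filter X) ≤ comap stoneCechUnit (𝓝 z) := Ultrafilter.of_le _
  have hcauchy : Cauchy (U : Filter X) := by
    rw [Metric.cauchy_iff]
    refine ⟨U.neBot, fun ε hε => ?_⟩
    obtain ⟨n, hn⟩ := hz (min 1 (ε / 2)) (by positivity)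
    have hmem : {x | truncDist X n x < min 1 (ε / 2)} ∈ (U : Filter X) := by
      refine hU (mem_of_superset (preimage_mem_comap
        ((isOpen_lt (G n).continuous continuous_const).mem_nhds hn)) fun x hx => ?_)
      rw [mem_ofPred_eq, ← hG]
      exact hx
    have hcover : (⋃ k ∈ Iic n, Metric.ball (TopologicalSpace.denseSeq X k) (ε / 2)) ∈ U := by
      refine mem_of_superset hmem fun x hx => ?_
      have hx' : Metric.infDist x (TopologicalSpace.denseSeq X '' Iic n) < ε / 2 := by
        rw [mem_ofPred_eq, truncDist_apply] at hx
        rcases min_lt_iff.mp hx with h | h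
        · exact absurd (h.trans_le (min_le_left _ _)) (lt_irrefl _)
        · exact h.trans_le (min_le_right _ _)
      obtain ⟨_, ⟨k, hk, rfl⟩, hd⟩ := (Metric.infDist_lt_iff (nonempty_Iic.image _)).mp hx'
      exact mem_biUnion hk hd
    obtain ⟨k, -, hk⟩ := (Ultrafilter.finite_biUnion_mem_iff (finite_Iic n)).mp hcover
    refine ⟨_, hk, fun x hx y hy => ?_⟩
    have := dist_triangle_right x y (TopologicalSpace.denseSeq X k)
    rw [Metric.mem_ball] at hx hy
    linarith
  obtain ⟨x, hx⟩ := CompleteSpace.complete hcauchy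
  have h₁ : Tendsto stoneCechUnit (U : Filter X) (𝓝 (stoneCechUnit x)) :=
    continuous_stoneCechUnit.continuousAt.mono_left hx
  have h₂ : Tendsto stoneCechUnit (U : Filter X) (𝓝 z) := tendsto_iff_comap.mpr hU
  exact ⟨x, tendsto_nhds_unique h₁ h₂⟩

/-- A normalized positive functional on `C_b(X)` which is small on some truncated distance functions
is integration against a Borel probability measure. -/
theorem exists_probabilityMeasure_integral_eq [CompleteSpace X] [MeasurableSpace X] [BorelSpace X]
    (l : (X →ᵇ ℝ) →ₗ[ℝ] ℝ) (hpos : ∀ f : X →ᵇ ℝ, (∀ x, 0 ≤ f x) → 0 ≤ l f)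
    (hone : l (BoundedContinuousFunction.const X 1) = 1)
    (htight : ∀ ε > 0, ∃ n, l (truncDist X n) < ε) :
    ∃ μ : ProbabilityMeasure X, ∀ f : X →ᵇ ℝ, ∫ x, f x ∂(μ : Measure X) = l f := by
  let e : X → StoneCech X := stoneCechUnit
  let : MeasurableSpace (StoneCech X) := borel _
  have : BorelSpace (StoneCech X) := ⟨rfl⟩
  let L : CompactlySupportedContinuousMap (StoneCech X) ℝ →ₚ[ℝ] ℝ := PositiveLinearMap.mk₀
    { toFun := fun F => l (stoneCechRestrict X F.toContinuousMap)
      map_add' := fun F G => by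
        rw [← map_add, ← map_add]; rfl
      map_smul' := fun c F => by
        rw [RingHom.id_apply, ← map_smul, ← map_smul]; rfl }
    fun F hF => hpos _ fun x => hF (e x)
  let ρ : Measure (StoneCech X) := RealRMK.rieszMeasure L
  have hρint : ∀ F : C(StoneCech X, ℝ), ∫ z, F z ∂ρ = l (stoneCechRestrict X F) := fun F =>
    RealRMK.integral_rieszMeasure L (CompactlySupportedContinuousMap.continuousMapEquiv F)
  have : IsFiniteMeasure ρ := by
    have : ρ.Regular := by dsimp only [ρ]; infer_instance
    exact CompactSpace.isFiniteMeasure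
  have hint : ∀ F : C(StoneCech X, ℝ), Integrable F ρ := fun F =>
    (BoundedContinuousFunction.mkOfCompact F).integrable ρ
  have : IsProbabilityMeasure ρ := by
    have h : ∫ _, (1 : ℝ) ∂ρ = 1 := by
      exact (hρint (ContinuousMap.const _ 1)).trans hone
    rw [integral_const, smul_eq_mul, mul_one] at h
    exact ⟨by rw [← ENNReal.toReal_eq_one_iff]; exact h⟩
  choose G hG using fun n => stoneCechRestrict_surjective X (truncDist X n)
  have hrange : range e = ⋂ k : ℕ, ⋃ n : ℕ, {z | G n z < 1 / ((k : ℝ) + 1)} := by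
    ext z
    simp only [mem_iInter, mem_iUnion, mem_ofPred_eq]
    constructor
    · rintro ⟨x, rfl⟩ k
      obtain ⟨n, hn⟩ := exists_truncDist_lt x (Nat.one_div_pos_of_nat (α := ℝ) (n := k))
      exact ⟨n, by rwa [← hG] at hn⟩
    · intro h
      refine mem_range_stoneCechUnit_of_truncDist hG fun ε hε => ?_
      obtain ⟨k, hk⟩ := exists_nat_one_div_lt hε
      obtain ⟨n, hn⟩ := h k
      exact ⟨n, hn.trans hk⟩
  have hmeas : MeasurableSet (range e) := by
    rw [hrange]
    exact MeasurableSet.iInter fun k => MeasurableSet.iUnion fun n =>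
      (isOpen_lt (G n).continuous continuous_const).measurableSet
  have he : MeasurableEmbedding e := isEmbedding_stoneCechUnit.measurableEmbedding hmeas
  have hnull : ρ (range e)ᶜ = 0 := by
    rw [hrange, compl_iInter, measure_iUnion_null_iff]
    intro k
    rw [compl_iUnion]
    rw [← measureReal_eq_zero_iff]
    refine le_antisymm (le_of_forall_pos_le_add fun ε hε => ?_) measureReal_nonneg
    have hk : (0 : ℝ) < 1 / ((k : ℝ) + 1) := Nat.one_div_pos_of_nat
    obtain ⟨n, hn⟩ := htight (1 / ((k : ℝ) + 1) * ε) (by positivity)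
    have hmarkov := mul_meas_ge_le_integral_of_nonneg (μ := ρ) (f := G n)
      (ae_of_all _ (stoneCech_nonneg_of_restrict_nonneg fun x => by
        rw [hG]; exact truncDist_nonneg n x)) (hint (G n)) (1 / ((k : ℝ) + 1))
    rw [hρint, hG] at hmarkov
    have hle := le_of_mul_le_mul_left (hmarkov.trans hn.le) hk
    rw [zero_add]
    refine le_trans (measureReal_mono fun z hz => ?_) hle
    have hz' : ¬ G n z < 1 / ((k : ℝ) + 1) := mem_iInter.mp hz n
    exact not_lt.mp hz'
  have hmap : (ρ.comap e).map e = ρ := by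
    rw [he.map_comap, Measure.restrict_eq_self_of_ae_mem]
    exact hnull
  have : IsProbabilityMeasure (ρ.comap e) := by
    have h : (ρ.comap e).map e univ = 1 := by rw [hmap]; exact measure_univ
    rw [he.map_apply, preimage_univ] at h
    exact ⟨h⟩
  refine ⟨⟨ρ.comap e, inferInstance⟩, fun f => ?_⟩
  obtain ⟨F, rfl⟩ := stoneCechRestrict_surjective X f
  rw [← hρint]
  conv_rhs => rw [← hmap]
  exact (he.integral_map _).symm

end TruncDist

/-- A superlinear functional is, at any given point, attained by a linear functional above it. -/
lemma exists_linearMap_ge_of_superlinear {E : Type*} [AddCommGroup E] [Module ℝ E] (u : E → ℝ)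
    (hhom : ∀ c : ℝ, 0 ≤ c → ∀ f, u (c • f) = c * u f) (hadd : ∀ f g, u f + u g ≤ u (f + g))
    (g : E) : ∃ l : E →ₗ[ℝ] ℝ, l g = u g ∧ ∀ f, u f ≤ l f := by
  have hzero : u 0 = 0 := by simpa using hhom 0 le_rfl 0
  have hneg : ∀ f, u f ≤ -u (-f) := fun f => by
    have := hadd f (-f)
    rw [add_neg_cancel, hzero] at this
    linarith
  let p : E →ₗ.[ℝ] ℝ := LinearPMap.mkSpanSingleton' g (u g) fun c hc => by
    rcases smul_eq_zero.mp hc with rfl | rfl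
    · simp
    · simp [hzero]
  obtain ⟨l, hl, hle⟩ := exists_extension_of_le_sublinear p (fun f => -u (-f))
    (fun c hc f => by rw [← smul_neg, hhom c hc.le]; ring)
    (fun f g => by
      have := hadd (-f) (-g)
      rw [neg_add]
      linarith)
    (by
      rintro ⟨x, hx⟩
      obtain ⟨c, rfl⟩ := Submodule.mem_span_singleton.mp hx
      rw [LinearPMap.mkSpanSingleton'_apply, RingHom.id_apply, smul_eq_mul]
      rcases le_total 0 c with hc | hc
      · rw [← hhom c hc]
        exact hneg _
      · change _ ≤ -u (-(c • g))
        rw [← neg_smul, hhom (-c) (by linarith)]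
        linarith)
  refine ⟨l, ?_, fun f => ?_⟩
  · have hg : g ∈ p.domain := Submodule.mem_span_singleton_self g
    exact (hl ⟨g, hg⟩).trans (LinearPMap.mkSpanSingleton'_apply_self _ _ _ _)
  · have := hle (-f)
    rw [neg_neg, map_neg] at this
    linarith

/-- A pointwise bounded sequence of linear functionals converges pointwise along any ultrafilter. -/
lemma exists_linearMap_tendsto_ultrafilter {E : Type*} [AddCommGroup E] [Module ℝ E]
    (l : ℕ → E →ₗ[ℝ] ℝ) (B : E → ℝ) (hB : ∀ n f, |l n f| ≤ B f) (U : Ultrafilter ℕ) :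
    ∃ L : E →ₗ[ℝ] ℝ, ∀ f, Tendsto (fun n => l n f) U (𝓝 (L f)) := by
  have hlim : ∀ f, ∃ a, Tendsto (fun n => l n f) U (𝓝 a) := fun f => by
    obtain ⟨a, -, ha⟩ := (isCompact_Icc (a := -B f) (b := B f)).ultrafilter_le_nhds
      (U.map fun n => l n f)
      (by
        rw [le_principal_iff]
        exact Eventually.of_forall (f := (U : Filter ℕ)) fun n => abs_le.mp (hB n f))
    exact ⟨a, ha⟩
  choose L hL using hlim
  exact ⟨linearMapOfTendsto L l (tendsto_pi_nhds.mpr hL), hL⟩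

section CoherentUtility

variable {X : Type*} [TopologicalSpace X] {u : (X →ᵇ ℝ) → ℝ}

lemma apply_const_of_ge {l : (X →ᵇ ℝ) →ₗ[ℝ] ℝ} (hu : ∀ a : ℝ, u (.const X a) = a)
    (hl : ∀ f, u f ≤ l f) (a : ℝ) : l (.const X a) = a := by
  have h₁ := hl (.const X a)
  have h₂ := hl (.const X (-a))
  rw [hu] at h₁ h₂
  have h₃ : BoundedContinuousFunction.const X (-a) = -BoundedContinuousFunction.const X a := rfl
  rw [h₃, map_neg] at h₂
  linarith

lemma abs_apply_le_norm {l : (X →ᵇ ℝ) →ₗ[ℝ] ℝ}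
    (hconst : ∀ a : ℝ, l (.const X a) = a)
    (hpos : ∀ f : X →ᵇ ℝ, (∀ x, 0 ≤ f x) → 0 ≤ l f) (f : X →ᵇ ℝ) : |l f| ≤ ‖f‖ := by
  have h₁ := hpos (.const X ‖f‖ - f) fun x => sub_nonneg.mpr (abs_le.mp (f.norm_coe_le_norm x)).2
  have h₂ := hpos (.const X ‖f‖ + f) fun x => by
    have := (abs_le.mp (f.norm_coe_le_norm x)).1
    change 0 ≤ ‖f‖ + f x
    linarith
  rw [map_sub, hconst] at h₁
  rw [map_add, hconst] at h₂
  exact abs_le.mpr ⟨by linarith, by linarith⟩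

/-- A coherent utility that is continuous along a decreasing sequence `G` is approximated at each
point by positive functionals which are arbitrarily small on that sequence. -/
theorem exists_linearMap_ge_small
    (hhom : ∀ c : ℝ, 0 ≤ c → ∀ f, u (c • f) = c * u f) (hadd : ∀ f g, u f + u g ≤ u (f + g))
    (hpos : ∀ f : X →ᵇ ℝ, (∀ x, 0 ≤ f x) → 0 ≤ u f) (hu : ∀ a : ℝ, u (.const X a) = a)
    (G : ℕ → X →ᵇ ℝ) (hG : ∀ n x, 0 ≤ G n x)
    (hcont : ∀ f, Tendsto (fun n => u (f + G n)) atTop (𝓝 (u f)))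
    (f : X →ᵇ ℝ) {ε : ℝ} (hε : 0 < ε) :
    ∃ l : (X →ᵇ ℝ) →ₗ[ℝ] ℝ, (∀ g, u g ≤ l g) ∧ l f ≤ u f + ε ∧
      ∀ δ > 0, ∃ n, l (G n) < δ := by
  have hstep : ∀ w : {w : X →ᵇ ℝ // u (f + w) < u f + ε},
      ∃ n, u (f + (w.1 + G n)) < u f + ε := fun w => by
    obtain ⟨n, hn⟩ := ((hcont (f + w.1)).eventually_lt_const w.2).exists
    exact ⟨n, by rwa [← add_assoc]⟩
  choose N hN using hstep
  let W : ℕ → {w : X →ᵇ ℝ // u (f + w) < u f + ε} := fun k =>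
    Nat.rec ⟨0, by rw [add_zero]; linarith⟩ (fun _ w => ⟨w.1 + G (N w), hN w⟩) k
  have hW0 : (W 0).1 = 0 := rfl
  have hWs : ∀ k, (W (k + 1)).1 = (W k).1 + G (N (W k)) := fun k => rfl
  have hWmono : ∀ x, Monotone fun k => (W k).1 x := fun x =>
    monotone_nat_of_le_succ fun k => by
      rw [hWs, BoundedContinuousFunction.add_apply]
      linarith [hG (N (W k)) x]
  choose l hl hul using fun k => exists_linearMap_ge_of_superlinear u hhom hadd (f + (W k).1)
  have hlpos : ∀ k, ∀ g : X →ᵇ ℝ, (∀ x, 0 ≤ g x) → 0 ≤ l k g := fun k g hg =>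
    (hpos g hg).trans (hul k g)
  obtain ⟨L, hL⟩ := exists_linearMap_tendsto_ultrafilter l (fun g => ‖g‖)
    (fun k => abs_apply_le_norm (apply_const_of_ge hu (hul k)) (hlpos k)) (hyperfilter ℕ)
  have huL : ∀ g, u g ≤ L g := fun g => ge_of_tendsto' (hL g) fun k => hul k g
  have hLW : ∀ k, L (f + (W k).1) ≤ u f + ε := fun k => by
    refine le_of_tendsto (hL _) (Nat.hyperfilter_le_atTop ?_)
    filter_upwards [eventually_ge_atTop k] with m hm
    have h := hlpos m ((W m).1 - (W k).1) fun x => sub_nonneg.mpr (hWmono x hm)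
    have h' := hl m
    rw [map_sub] at h
    rw [map_add] at h' ⊢
    have := (W m).2
    linarith
  refine ⟨L, huL, by simpa [hW0] using hLW 0, fun δ hδ => ?_⟩
  by_contra! hcon
  have hgrow : ∀ k : ℕ, k * δ ≤ L (W k).1 := fun k => by
    induction k with
    | zero => simp [hW0]
    | succ k ih =>
      rw [hWs, map_add]
      push_cast
      linarith [hcon (N (W k))]
  obtain ⟨k, hk⟩ := exists_nat_gt (ε / δ)
  have h₁ := hLW k
  rw [map_add] at h₁
  have h₂ := huL f
  have h₃ := hgrow k
  rw [div_lt_iff₀ hδ] at hk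
  linarith

end CoherentUtility

/-- Main theorem: a coherent monetary utility function on C_b(X) with the Fatou property,
X Polish, is representable by a weak*-closed convex set of Borel probability measures. -/
theorem coherent_utility_representation
    {X : Type*} [TopologicalSpace X] [PolishSpace X]
    [MeasurableSpace X] [BorelSpace X]
    (u : (X →ᵇ ℝ) → ℝ)
    (hconc : ∀ f g : X →ᵇ ℝ, ∀ t : ℝ, 0 ≤ t → t ≤ 1 →
      t * u f + (1 - t) * u g ≤ u (t • f + (1 - t) • g))
    (hhom : ∀ (c : ℝ), 0 ≤ c → ∀ f : X →ᵇ ℝ, u (c • f) = c * u f)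
    (hpos : ∀ f : X →ᵇ ℝ, (∀ x, 0 ≤ f x) → 0 ≤ u f)
    (hcash : ∀ f : X →ᵇ ℝ, ∀ a : ℝ, u (f + BoundedContinuousFunction.const X a) = u f + a)
    (hFatou : ∀ (f : ℕ → X →ᵇ ℝ) (g : X →ᵇ ℝ),
      (∀ x, Antitone fun n => f n x) → (∀ x, Tendsto (fun n => f n x) atTop (nhds (g x))) →
      Antitone (fun n => u (f n)) ∧ Tendsto (fun n => u (f n)) atTop (nhds (u g))) :
    ∃ S₀ : Set (ProbabilityMeasure X),
      IsClosed S₀ ∧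
      (∀ μ ∈ S₀, ∀ ν ∈ S₀, ∀ t : NNReal, t ≤ 1 →
        ∃ σ ∈ S₀, (σ : Measure X) = t • (μ : Measure X) + (1 - t) • (ν : Measure X)) ∧
      ∀ f : X →ᵇ ℝ,
        u f = sInf {r : ℝ | ∃ μ ∈ S₀, r = ∫ x, f x ∂(μ : Measure X)} := by
  have hadd : ∀ f g, u f + u g ≤ u (f + g) := fun f g => by
    have h := hconc f g (1 / 2) (by norm_num) (by norm_num)
    have h' : (1 / 2 : ℝ) • f + (1 - 1 / 2 : ℝ) • g = (1 / 2 : ℝ) • (f + g) := by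
      rw [smul_add]; norm_num
    rw [h', hhom _ (by norm_num)] at h
    linarith
  have hzero : u 0 = 0 := by simpa using hhom 0 le_rfl 0
  have hconst : ∀ a : ℝ, u (.const X a) = a := fun a => by
    simpa [hzero] using hcash 0 a
  have : Nonempty X := by
    by_contra hX
    have := not_nonempty_iff.mp hX
    have h := hconst 1
    have h₀ : BoundedContinuousFunction.const X (1 : ℝ) = 0 := by
      ext x
      exact isEmptyElim x
    rw [h₀, hzero] at h
    exact zero_ne_one h
  let S₀ : Set (ProbabilityMeasure X) := {μ | ∀ f : X →ᵇ ℝ, u f ≤ ∫ x, f x ∂(μ : Measure X)}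
  have happrox : ∀ f : X →ᵇ ℝ, ∀ ε > 0, ∃ μ ∈ S₀, ∫ x, f x ∂(μ : Measure X) ≤ u f + ε := by
    intro f ε hε
    let := TopologicalSpace.upgradeIsCompletelyMetrizable X
    obtain ⟨l, hul, hlf, hsmall⟩ := exists_linearMap_ge_small hhom hadd hpos hconst
      (truncDist X) truncDist_nonneg
      (fun g => (hFatou (fun n => g + truncDist X n) g
        (fun x m n hmn => add_le_add_right (truncDist_antitone x hmn) (g x))
        (fun x => by simpa using (tendsto_truncDist x).const_add (g x))).2) f hε
    obtain ⟨μ, hμ⟩ := exists_probabilityMeasure_integral_eq l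
      (fun g hg => (hpos g hg).trans (hul g)) (apply_const_of_ge hconst hul 1) hsmall
    exact ⟨μ, fun g => (hμ g).symm ▸ hul g, (hμ f).symm ▸ hlf⟩
  refine ⟨S₀, ?_, ?_, fun f => ?_⟩
  · have : S₀ = ⋂ f : X →ᵇ ℝ, {μ : ProbabilityMeasure X | u f ≤ ∫ x, f x ∂(μ : Measure X)} := by
      ext μ
      simp [S₀]
    rw [this]
    exact isClosed_iInter fun f => isClosed_le continuous_const
      (ProbabilityMeasure.continuous_integral_boundedContinuousFunction f)
  · intro μ hμ ν hν t ht
    have hprob : IsProbabilityMeasure (t • (μ : Measure X) + (1 - t) • (ν : Measure X)) := by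
      constructor
      simp only [Measure.add_apply, Measure.smul_apply, measure_univ, ENNReal.smul_def,
        smul_eq_mul, mul_one]
      rw [← ENNReal.coe_add, add_tsub_cancel_of_le ht, ENNReal.coe_one]
    refine ⟨⟨_, hprob⟩, fun f => ?_, rfl⟩
    have hμf : Integrable f (t • (μ : Measure X)) := (f.integrable _).smul_measure_nnreal
    have hνf : Integrable f ((1 - t) • (ν : Measure X)) := (f.integrable _).smul_measure_nnreal
    change u f ≤ ∫ x, f x ∂(t • (μ : Measure X) + (1 - t) • (ν : Measure X))
    rw [integral_add_measure hμf hνf, integral_smul_nnreal_measure, integral_smul_nnreal_measure,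
      NNReal.smul_def, NNReal.smul_def, NNReal.coe_sub ht, smul_eq_mul, smul_eq_mul]
    have h₁ := mul_le_mul_of_nonneg_left (hμ f) t.2
    have h₂ := mul_le_mul_of_nonneg_left (hν f) (sub_nonneg.mpr (NNReal.coe_le_coe.mpr ht))
    simp only [NNReal.val_eq_coe, NNReal.coe_one] at h₁ h₂ ⊢
    linarith
  · have hlb : ∀ r ∈ {r : ℝ | ∃ μ ∈ S₀, r = ∫ x, f x ∂(μ : Measure X)}, u f ≤ r := by
      rintro r ⟨μ, hμ, rfl⟩
      exact hμ f
    obtain ⟨μ₀, hμ₀, -⟩ := happrox f 1 one_pos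
    refine le_antisymm (le_csInf ⟨_, μ₀, hμ₀, rfl⟩ hlb) (le_of_forall_pos_le_add fun ε hε => ?_)
    obtain ⟨μ, hμ, hle⟩ := happrox f ε hε
    exact (csInf_le ⟨u f, hlb⟩ ⟨μ, hμ, rfl⟩).trans hle
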